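/- Let N ≥ 5 be an integer and p > 1 a real number. Let u ∈ C⁴(ℝ^N) be a classical stable solution of Δ²u = u^p, u > 0 in ℝ^N, and set v = −Δu. Then v(x) ≥ √(2/(p+1)) · u(x)^{(p+1)/2} for every x ∈ ℝ^N; in particular v > 0 everywhere in ℝ^N. -/

import Mathlib

open MeasureTheory Real

/-- The Laplacian of a function on `ℝ^N` (sum of pure second derivatives). -/
noncomputable def lap {N : ℕ} (u : EuclideanSpace ℝ (Fin N) → ℝ)
    (x : EuclideanSpace ℝ (Fin N)) : ℝ :=
  ∑ i : Fin N, fderiv ℝ (fun y => fderiv ℝ u y (EuclideanSpace.single i 1)) x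
    (EuclideanSpace.single i 1)

open Set Filter Topology

theorem contDiff_fderiv_apply {E : Type*} [NormedAddCommGroup E] [NormedSpace ℝ E]
    {n m : WithTop ℕ∞} {f : E → ℝ} (hf : ContDiff ℝ n f) (h : m + 1 ≤ n) (v : E) :
    ContDiff ℝ m (fun x => fderiv ℝ f x v) :=
  (hf.fderiv_right h).clm_apply contDiff_const

theorem contDiff_lap {N : ℕ} {n m : WithTop ℕ∞} {f : EuclideanSpace ℝ (Fin N) → ℝ}
    (hf : ContDiff ℝ n f) (h : m + 1 + 1 ≤ n) : ContDiff ℝ m (lap f) :=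
  ContDiff.sum fun _ _ => contDiff_fderiv_apply (contDiff_fderiv_apply hf h _) le_rfl _

theorem support_lap_subset {N : ℕ} (f : EuclideanSpace ℝ (Fin N) → ℝ) :
    Function.support (lap f) ⊆ tsupport f := by
  intro x hx
  by_contra hx'
  refine hx (Finset.sum_eq_zero fun i _ => ?_)
  have h1 : tsupport (fun y => fderiv ℝ f y (EuclideanSpace.single i 1)) ⊆ tsupport f :=
    tsupport_fderiv_apply_subset ℝ _
  have h2 : x ∉ tsupport (fun y => fderiv ℝ f y (EuclideanSpace.single i 1)) :=
    fun h => hx' (h1 h)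
  have h3 := fun h => h2 (tsupport_fderiv_subset ℝ h)
  rw [image_eq_zero_of_notMem_tsupport h3]
  rfl

theorem hasCompactSupport_lap {N : ℕ} {f : EuclideanSpace ℝ (Fin N) → ℝ}
    (hf : HasCompactSupport f) : HasCompactSupport (lap f) :=
  hf.mono' (support_lap_subset f)

theorem fderiv_comp_add_smul {E : Type*} [NormedAddCommGroup E] [NormedSpace ℝ E]
    (f : E → ℝ) (a : E) (r : ℝ) (y : E) :
    fderiv ℝ (fun y => f (a + r • y)) y = r • fderiv ℝ f (a + r • y) := by
  have h := fderiv_comp_smul (f := fun y => f (a + y)) (x := y) r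
  rw [h, fderiv_comp_add_left]

theorem lap_comp_add_smul {N : ℕ} (f : EuclideanSpace ℝ (Fin N) → ℝ)
    (a : EuclideanSpace ℝ (Fin N)) (r : ℝ) (y : EuclideanSpace ℝ (Fin N)) :
    lap (fun y => f (a + r • y)) y = r ^ 2 * lap f (a + r • y) := by
  unfold lap
  rw [Finset.mul_sum]
  refine Finset.sum_congr rfl fun i _ => ?_
  have h : (fun y => fderiv ℝ (fun y => f (a + r • y)) y (EuclideanSpace.single i 1))
      = fun y => r • (fun z => fderiv ℝ f z (EuclideanSpace.single i 1)) (a + r • y) := by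
    funext y
    simp [fderiv_comp_add_smul]
  have h1 := congrFun (fderiv_const_smul_field (𝕜 := ℝ) r (f := fun y =>
    (fun z => fderiv ℝ f z (EuclideanSpace.single i 1)) (a + r • y))) y
  have h2 := fderiv_comp_add_smul (fun z => fderiv ℝ f z (EuclideanSpace.single i 1)) a r y
  rw [h]
  refine (congrArg (· (EuclideanSpace.single i 1)) h1).trans ?_
  simp only [Pi.smul_apply, h2, smul_smul, smul_apply, smul_eq_mul]
  ring

theorem lap_add_const_mul {N : ℕ} {f g : EuclideanSpace ℝ (Fin N) → ℝ}
    {x : EuclideanSpace ℝ (Fin N)} (hf : ContDiffAt ℝ 2 f x) (hg : ContDiffAt ℝ 2 g x) (c : ℝ) :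
    lap (fun y => f y + c * g y) x = lap f x + c * lap g x := by
  unfold lap
  rw [Finset.mul_sum, ← Finset.sum_add_distrib]
  refine Finset.sum_congr rfl fun i _ => ?_
  have hf1 := (hf.eventually (by simp)).mono fun y hy => hy.differentiableAt (by simp)
  have hg1 := (hg.eventually (by simp)).mono fun y hy => hy.differentiableAt (by simp)
  have h : (fun y => fderiv ℝ (fun y => f y + c * g y) y (EuclideanSpace.single i 1))
      =ᶠ[𝓝 x] fun y => fderiv ℝ f y (EuclideanSpace.single i 1)
        + c * fderiv ℝ g y (EuclideanSpace.single i 1) := by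
    filter_upwards [hf1, hg1] with y h1 h2
    rw [fderiv_fun_add h1 (h2.const_mul c), fderiv_const_mul h2]; rfl
  have hd : ∀ {k : EuclideanSpace ℝ (Fin N) → ℝ}, ContDiffAt ℝ 2 k x → DifferentiableAt ℝ
      (fun y => fderiv ℝ k y (EuclideanSpace.single i 1)) x := fun hk =>
    (((hk.fderiv_right (m := 1) (by norm_num)).clm_apply contDiffAt_const).differentiableAt
      (by simp))
  rw [h.fderiv_eq, fderiv_fun_add (hd hf) ((hd hg).const_mul c), fderiv_const_mul (hd hg)]
  rfl

/-- The Laplacian of a real power of a positive function. -/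
theorem lap_rpow {N : ℕ} {f : EuclideanSpace ℝ (Fin N) → ℝ}
    {x : EuclideanSpace ℝ (Fin N)} (hf : ContDiffAt ℝ 2 f x) (hx : 0 < f x) (a : ℝ) :
    lap (fun y => f y ^ a) x
      = a * (a - 1) * f x ^ (a - 2)
          * ∑ i : Fin N, fderiv ℝ f x (EuclideanSpace.single i 1) ^ 2
        + a * f x ^ (a - 1) * lap f x := by
  unfold lap
  rw [Finset.mul_sum, Finset.mul_sum, ← Finset.sum_add_distrib]
  refine Finset.sum_congr rfl fun i _ => ?_
  have hf1 := (hf.eventually (by simp)).mono fun y hy => hy.differentiableAt (by simp)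
  have hpos : ∀ᶠ y in 𝓝 x, 0 < f y := hf.continuousAt.eventually (lt_mem_nhds hx)
  have h : (fun y => fderiv ℝ (fun y => f y ^ a) y (EuclideanSpace.single i 1))
      =ᶠ[𝓝 x] fun y => (a * f y ^ (a - 1)) * fderiv ℝ f y (EuclideanSpace.single i 1) := by
    filter_upwards [hf1, hpos] with y h1 h2
    rw [(h1.hasFDerivAt.rpow_const (Or.inl h2.ne')).fderiv]
    simp
  have hd : DifferentiableAt ℝ (fun y => fderiv ℝ f y (EuclideanSpace.single i 1)) x :=
    (((hf.fderiv_right (m := 1) (by norm_num)).clm_apply contDiffAt_const).differentiableAt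
      (by simp))
  have hp := ((hf1.self_of_nhds.hasFDerivAt.rpow_const (p := a - 1)
    (Or.inl hx.ne')).const_mul a).mul hd.hasFDerivAt
  rw [h.fderiv_eq]
  refine (congrArg (· (EuclideanSpace.single i 1)) hp.fderiv).trans ?_
  simp [show a - 1 - 1 = a - 2 by ring]
  ring

theorem lap_nonpos_of_isLocalMax {N : ℕ} {f : EuclideanSpace ℝ (Fin N) → ℝ}
    {x : EuclideanSpace ℝ (Fin N)} (hf : ContDiffAt ℝ 2 f x) (hx : IsLocalMax f x) :
    lap f x ≤ 0 := by
  refine Finset.sum_nonpos fun i _ => ?_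
  set v : EuclideanSpace ℝ (Fin N) := EuclideanSpace.single i 1
  by_contra! hlt
  have hline : ∀ t : ℝ, HasDerivAt (fun t : ℝ => x + t • v) v t := fun t => by
    simpa using ((hasDerivAt_id t).smul_const v).const_add x
  have hcont : Tendsto (fun t : ℝ => x + t • v) (𝓝 0) (𝓝 x) := by
    simpa using (hline 0).continuousAt.tendsto
  have hf1 := (hf.eventually (by simp)).mono fun y hy => hy.differentiableAt (by simp)
  have hd1 : deriv (fun t : ℝ => f (x + t • v)) =ᶠ[𝓝 0] fun t => fderiv ℝ f (x + t • v) v := by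
    filter_upwards [hcont.eventually hf1] with t ht
    exact (ht.hasFDerivAt.comp_hasDerivAt t (hline t)).deriv
  have hd : DifferentiableAt ℝ (fun y => fderiv ℝ f y v) x :=
    (((hf.fderiv_right (m := 1) (by norm_num)).clm_apply contDiffAt_const).differentiableAt
      (by simp))
  have hd2 : deriv (deriv fun t : ℝ => f (x + t • v)) 0
      = fderiv ℝ (fun y => fderiv ℝ f y v) x v := by
    rw [hd1.deriv_eq]
    have hd' : HasFDerivAt (fun y => fderiv ℝ f y v) (fderiv ℝ (fun y => fderiv ℝ f y v) x)
        (x + (0 : ℝ) • v) := by simpa using hd.hasFDerivAt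
    exact (hd'.comp_hasDerivAt 0 (hline 0)).deriv
  have hmax : IsLocalMax (fun t : ℝ => f (x + t • v)) 0 := by
    have := hcont.eventually hx
    simpa [IsLocalMax, IsMaxFilter] using this
  have hmin : IsLocalMin (fun t : ℝ => f (x + t • v)) 0 := by
    refine isLocalMin_of_deriv_deriv_pos (hd2 ▸ hlt) hmax.deriv_eq_zero ?_
    exact ContinuousAt.comp (f := fun t : ℝ => x + t • v) (by simpa using hf.continuousAt)
      (hline 0).continuousAt
  have hconst : (fun t : ℝ => f (x + t • v)) =ᶠ[𝓝 0] fun _ => f (x + (0 : ℝ) • v) := by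
    filter_upwards [hmax, hmin] with t h1 h2
    exact le_antisymm h1 h2
  have h0 := hconst.deriv.deriv_eq
  rw [hd2] at h0
  simp at h0
  exact hlt.ne' h0

theorem hasFDerivAt_one_sub_norm_sq {E : Type*} [NormedAddCommGroup E] [InnerProductSpace ℝ E]
    (y : E) : HasFDerivAt (fun y : E => 1 - ‖y‖ ^ 2) (-(2 • innerSL ℝ y)) y :=
  (hasStrictFDerivAt_norm_sq y).hasFDerivAt.const_sub 1

theorem fderiv_one_sub_norm_sq_single {N : ℕ} (y : EuclideanSpace ℝ (Fin N)) (i : Fin N) :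
    fderiv ℝ (fun y : EuclideanSpace ℝ (Fin N) => 1 - ‖y‖ ^ 2) y (EuclideanSpace.single i 1)
      = -2 * y i := by
  rw [(hasFDerivAt_one_sub_norm_sq y).fderiv]
  simp [EuclideanSpace.inner_single_right]

theorem lap_one_sub_norm_sq {N : ℕ} (y : EuclideanSpace ℝ (Fin N)) :
    lap (fun y : EuclideanSpace ℝ (Fin N) => 1 - ‖y‖ ^ 2) y = -2 * N := by
  unfold lap
  simp_rw [fderiv_one_sub_norm_sq_single]
  have h : ∀ i : Fin N, fderiv ℝ (fun y : EuclideanSpace ℝ (Fin N) => -2 * y i) y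
      (EuclideanSpace.single i 1) = -2 := fun i => by
    have := ((EuclideanSpace.proj i : EuclideanSpace ℝ (Fin N) →L[ℝ] ℝ).hasFDerivAt
      (x := y)).const_mul (-2)
    refine (congrArg (· (EuclideanSpace.single i 1)) this.fderiv).trans ?_
    simp
  simp_rw [h]
  simp
  ring

/-- The blow-up barrier `(1 - |y|²)^(-β)` on the unit ball. -/
theorem lap_barrier_le {N : ℕ} {β : ℝ} (hβ : 0 < β) {y : EuclideanSpace ℝ (Fin N)}
    (hy : 0 < 1 - ‖y‖ ^ 2) :
    lap (fun y : EuclideanSpace ℝ (Fin N) => (1 - ‖y‖ ^ 2) ^ (-β)) y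
      ≤ (4 * β * (β + 1) + 2 * β * N) * (1 - ‖y‖ ^ 2) ^ (-β - 2) := by
  have hc : ContDiffAt ℝ 2 (fun y : EuclideanSpace ℝ (Fin N) => 1 - ‖y‖ ^ 2) y :=
    contDiffAt_const.sub (contDiff_norm_sq ℝ).contDiffAt
  rw [lap_rpow hc hy, lap_one_sub_norm_sq]
  simp_rw [fderiv_one_sub_norm_sq_single, mul_pow]
  rw [← Finset.mul_sum, ← EuclideanSpace.real_norm_sq_eq]
  set t := 1 - ‖y‖ ^ 2 with ht
  have ht1 : t ≤ 1 := by nlinarith [sq_nonneg ‖y‖]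
  have h1 : t ^ (-β - 1) = t * t ^ (-β - 2) := by
    rw [show -β - 1 = 1 + (-β - 2) by ring, Real.rpow_add hy, Real.rpow_one]
  have hP : 0 < t ^ (-β - 2) := Real.rpow_pos_of_pos hy _
  have hn : ‖y‖ ^ 2 = 1 - t := by rw [ht]; ring
  rw [h1, hn]
  have h2 : 4 * β * (β + 1) * (1 - t) + 2 * β * N * t ≤ 4 * β * (β + 1) + 2 * β * N := by
    have : 0 ≤ 2 * β * N * (1 - t) := mul_nonneg (by positivity) (by linarith)
    have : 0 ≤ 4 * β * (β + 1) * t := by positivity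
    nlinarith
  calc _ = (4 * β * (β + 1) * (1 - t) + 2 * β * N * t) * t ^ (-β - 2) := by ring
    _ ≤ _ := mul_le_mul_of_nonneg_right h2 hP.le

/-- Interior bound of Keller–Osserman type at the centre of the unit ball. -/
theorem rpow_le_of_lap_ge {N : ℕ} {w : EuclideanSpace ℝ (Fin N) → ℝ} (hw : ContDiff ℝ 2 w)
    {c s : ℝ} (hc : 0 < c) (hs : 1 < s) (hlap : ∀ x, 0 < w x → c * w x ^ s ≤ lap w x)
    (h0 : 0 < w 0) :
    c * w 0 ^ (s - 1) ≤ 4 * (2 / (s - 1)) * (2 / (s - 1) + 1) + 2 * (2 / (s - 1)) * N := by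
  set β := 2 / (s - 1) with hβdef
  have hβ : 0 < β := div_pos two_pos (by linarith)
  have hβs : β * s = β + 2 := by
    rw [hβdef]; field_simp [show s - 1 ≠ 0 by linarith]; ring
  set ζ : EuclideanSpace ℝ (Fin N) → ℝ := fun y => 1 - ‖y‖ ^ 2 with hζ
  have hζc : Continuous ζ := by fun_prop
  have hfc : Continuous fun y => ζ y ^ β * w y :=
    (hζc.rpow_const fun _ => Or.inr hβ.le).mul hw.continuous
  obtain ⟨y, hyB, hy⟩ := (isCompact_closedBall (0 : EuclideanSpace ℝ (Fin N)) 1).exists_isMaxOn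
    ⟨0, by simp⟩ hfc.continuousOn
  have hM0 : w 0 ≤ ζ y ^ β * w y := by
    have := hy (show (0 : EuclideanSpace ℝ (Fin N)) ∈ Metric.closedBall 0 1 by simp)
    simpa [hζ] using this
  set M := ζ y ^ β * w y with hM
  have hMpos : 0 < M := h0.trans_le hM0
  have hζy : 0 < ζ y := by
    have h1 : ‖y‖ ≤ 1 := by simpa using hyB
    have h2 : 0 ≤ ζ y := by simp only [hζ]; nlinarith [norm_nonneg y]
    refine h2.lt_of_ne fun h => ?_
    rw [hM, ← h, Real.zero_rpow hβ.ne', zero_mul] at hMpos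
    exact hMpos.false
  have hwy : w y = M * ζ y ^ (-β) := by
    rw [hM, Real.rpow_neg hζy.le]
    field_simp [(Real.rpow_pos_of_pos hζy β).ne']
  have hbc : ContDiffAt ℝ 2 (fun y => ζ y ^ (-β)) y :=
    (contDiffAt_const.sub (contDiff_norm_sq ℝ).contDiffAt).rpow_const_of_ne hζy.ne'
  have hmax : IsLocalMax (fun z => w z + -M * ζ z ^ (-β)) y := by
    filter_upwards [hζc.continuousAt.eventually (lt_mem_nhds hζy)] with z hz
    have hzB : z ∈ Metric.closedBall (0 : EuclideanSpace ℝ (Fin N)) 1 := by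
      have : ‖z‖ ^ 2 < 1 := by simpa [hζ] using hz
      simp only [mem_closedBall_zero_iff]
      nlinarith [norm_nonneg z]
    have h1 : ζ z ^ β * w z ≤ M := hy hzB
    have h2 : w z ≤ M * ζ z ^ (-β) := by
      rw [Real.rpow_neg hz.le, ← div_eq_mul_inv, le_div_iff₀ (Real.rpow_pos_of_pos hz β)]
      linarith
    linarith
  have hle := lap_nonpos_of_isLocalMax (hw.contDiffAt.add (contDiffAt_const.mul hbc)) hmax
  rw [lap_add_const_mul hw.contDiffAt hbc] at hle
  have hP : 0 < ζ y ^ (-β - 2) := Real.rpow_pos_of_pos hζy _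
  have hbar := mul_le_mul_of_nonneg_left (lap_barrier_le hβ hζy) hMpos.le
  have hwpos : 0 < w y := by rw [hwy]; positivity
  have hge := hlap y hwpos
  have hws : w y ^ s = M * M ^ (s - 1) * ζ y ^ (-β - 2) := by
    rw [hwy, Real.mul_rpow hMpos.le (Real.rpow_nonneg hζy.le _), ← Real.rpow_mul hζy.le,
      show -β * s = -β - 2 by linarith]
    congr 1
    nth_rewrite 2 [← Real.rpow_one M]
    rw [← Real.rpow_add hMpos]
    congr 1; ring
  rw [hws] at hge
  have hfin : (M * ζ y ^ (-β - 2)) * (c * M ^ (s - 1))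
      ≤ (M * ζ y ^ (-β - 2)) * (4 * β * (β + 1) + 2 * β * N) := by
    simp only [hζ] at *
    linarith
  refine le_trans ?_ (le_of_mul_le_mul_left hfin (by positivity))
  gcongr

/-- Liouville theorem of Keller–Osserman type. -/
theorem nonpos_of_lap_ge {N : ℕ} {w : EuclideanSpace ℝ (Fin N) → ℝ} (hw : ContDiff ℝ 2 w)
    {c s : ℝ} (hc : 0 < c) (hs : 1 < s) (hlap : ∀ x, 0 < w x → c * w x ^ s ≤ lap w x)
    (x : EuclideanSpace ℝ (Fin N)) : w x ≤ 0 := by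
  by_contra! hx
  set K := 4 * (2 / (s - 1)) * (2 / (s - 1) + 1) + 2 * (2 / (s - 1)) * N
  have key : ∀ R : ℝ, 0 < R → R ^ 2 * (c * w x ^ (s - 1)) ≤ K := fun R hR => by
    have h := rpow_le_of_lap_ge (w := fun y => w (x + R • y)) (c := R ^ 2 * c) (s := s)
      (hw.comp (contDiff_const.add (contDiff_id.const_smul R))) (by positivity) hs
      (fun y hy => by
        rw [lap_comp_add_smul, mul_assoc]
        exact mul_le_mul_of_nonneg_left (hlap _ hy) (by positivity)) (by simpa using hx)
    rw [← mul_assoc]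
    simpa only [smul_zero, add_zero] using h
  have hp : 0 < c * w x ^ (s - 1) := mul_pos hc (Real.rpow_pos_of_pos hx _)
  have ht : Tendsto (fun R : ℝ => R ^ 2 * (c * w x ^ (s - 1))) atTop atTop :=
    (tendsto_pow_atTop two_ne_zero).atTop_mul_const hp
  obtain ⟨R, hR1, hR2⟩ := ((ht.eventually_gt_atTop K).and (eventually_gt_atTop 0)).exists
  exact (key R hR2).not_gt hR1

theorem integral_fderiv_apply_mul {N : ℕ} {f g : EuclideanSpace ℝ (Fin N) → ℝ}
    (hf : ContDiff ℝ 1 f) (hg : ContDiff ℝ 1 g) (hgs : HasCompactSupport g)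
    (v : EuclideanSpace ℝ (Fin N)) :
    ∫ x, f x * fderiv ℝ g x v = -∫ x, fderiv ℝ f x v * g x := by
  have hf' : Continuous fun x => fderiv ℝ f x v :=
    (contDiff_fderiv_apply (m := 0) hf (by simp) v).continuous
  have hg' : Continuous fun x => fderiv ℝ g x v :=
    (contDiff_fderiv_apply (m := 0) hg (by simp) v).continuous
  exact integral_mul_fderiv_eq_neg_fderiv_mul_of_integrable
    ((hf'.mul hg.continuous).integrable_of_hasCompactSupport hgs.mul_left)
    ((hf.continuous.mul hg').integrable_of_hasCompactSupport (hgs.fderiv_apply ℝ v).mul_left)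
    ((hf.continuous.mul hg.continuous).integrable_of_hasCompactSupport hgs.mul_left)
    (fun x _ => hf.differentiable one_ne_zero x) (fun x _ => hg.differentiable one_ne_zero x)

theorem integral_sum_fderiv_mul_fderiv {N : ℕ} {f g : EuclideanSpace ℝ (Fin N) → ℝ}
    (hf : ContDiff ℝ 2 f) (hg : ContDiff ℝ 1 g) (hgs : HasCompactSupport g) :
    ∑ i : Fin N, ∫ x, fderiv ℝ f x (EuclideanSpace.single i 1)
        * fderiv ℝ g x (EuclideanSpace.single i 1) = -∫ x, lap f x * g x := by
  have h2 : (1 : WithTop ℕ∞) + 1 ≤ 2 := by norm_num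
  have hi : ∀ i ∈ Finset.univ, Integrable fun x : EuclideanSpace ℝ (Fin N) =>
      fderiv ℝ (fun y => fderiv ℝ f y (EuclideanSpace.single i 1)) x (EuclideanSpace.single i 1)
        * g x := fun i _ =>
    ((contDiff_fderiv_apply (m := 0) (contDiff_fderiv_apply hf h2 _) (by simp)
      _).continuous.mul hg.continuous).integrable_of_hasCompactSupport hgs.mul_left
  simp_rw [lap, Finset.sum_mul]
  rw [integral_finsetSum _ hi, ← Finset.sum_neg_distrib]
  exact Finset.sum_congr rfl fun i _ =>
    integral_fderiv_apply_mul (contDiff_fderiv_apply hf h2 _) hg hgs _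

/-- Green's second identity with a compactly supported factor. -/
theorem integral_lap_mul {N : ℕ} {f g : EuclideanSpace ℝ (Fin N) → ℝ}
    (hf : ContDiff ℝ 2 f) (hg : ContDiff ℝ 2 g) (hgs : HasCompactSupport g) :
    ∫ x, lap f x * g x = ∫ x, f x * lap g x := by
  have h2 : (1 : WithTop ℕ∞) + 1 ≤ 2 := by norm_num
  have h12 : (1 : WithTop ℕ∞) ≤ 2 := by norm_num
  have hi : ∀ i ∈ Finset.univ, Integrable fun x : EuclideanSpace ℝ (Fin N) =>
      f x * fderiv ℝ (fun y => fderiv ℝ g y (EuclideanSpace.single i 1)) x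
        (EuclideanSpace.single i 1) := fun i _ =>
    (hf.continuous.mul (contDiff_fderiv_apply (m := 0) (contDiff_fderiv_apply hg h2 _) (by simp)
      _).continuous).integrable_of_hasCompactSupport
        (HasCompactSupport.mul_left ((hgs.fderiv_apply ℝ _).fderiv_apply ℝ _))
  have h := integral_sum_fderiv_mul_fderiv hf (hg.of_le h12) hgs
  rw [← neg_eq_iff_eq_neg] at h
  rw [← h]
  simp_rw [lap, Finset.mul_sum]
  rw [integral_finsetSum _ hi, ← Finset.sum_neg_distrib]
  refine Finset.sum_congr rfl fun i _ => ?_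
  rw [integral_fderiv_apply_mul (hf.of_le h12) (contDiff_fderiv_apply hg h2 _)
    (hgs.fderiv_apply ℝ _)]

theorem hasDerivAt_integral_comp_add_smul {N : ℕ} {z η : EuclideanSpace ℝ (Fin N) → ℝ}
    (hz : ContDiff ℝ 1 z) (hη : Continuous η) (hηs : HasCompactSupport η)
    (a : EuclideanSpace ℝ (Fin N)) (r : ℝ) :
    HasDerivAt (fun r : ℝ => ∫ y, z (a + r • y) * η y)
      (∫ y, fderiv ℝ z (a + r • y) y * η y) r := by
  have hG : Continuous fun q : ℝ × EuclideanSpace ℝ (Fin N) => fderiv ℝ z (a + q.1 • q.2) q.2 :=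
    ((hz.continuous_fderiv one_ne_zero).comp (by fun_prop)).clm_apply continuous_snd
  obtain ⟨C, hC⟩ := ((isCompact_closedBall r 1).prod hηs.isCompact).exists_bound_of_continuousOn
    hG.continuousOn
  have hzc := hz.continuous
  refine (hasDerivAt_integral_of_dominated_loc_of_deriv_le (bound := fun y => C * ‖η y‖)
    (F' := fun r y => fderiv ℝ z (a + r • y) y * η y)
    (Metric.closedBall_mem_nhds r one_pos) ?_ ?_ ?_ ?_ ?_ ?_).2
  · exact Eventually.of_forall fun r => by fun_prop
  · exact Continuous.integrable_of_hasCompactSupport (by fun_prop) hηs.mul_left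
  · exact Continuous.aestronglyMeasurable
      ((hG.comp (Continuous.prodMk_right r)).mul hη)
  · refine Eventually.of_forall fun y r' hr' => ?_
    rw [norm_mul]
    by_cases hy : y ∈ tsupport η
    · exact mul_le_mul_of_nonneg_right (hC (r', y) ⟨hr', hy⟩) (norm_nonneg _)
    · simp [image_eq_zero_of_notMem_tsupport hy]
  · exact Continuous.integrable_of_hasCompactSupport (by fun_prop) hηs.norm.mul_left
  · refine Eventually.of_forall fun y r' _ => ?_
    have h1 : HasDerivAt (fun r : ℝ => a + r • y) y r' := by
      simpa using ((hasDerivAt_id r').smul_const y).const_add a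
    exact ((hz.differentiable one_ne_zero _).hasFDerivAt.comp_hasDerivAt r' h1).mul_const _

/-- Mean value inequality for a subharmonic function, with a weight `η` such that `y η(y)` is the
gradient of a nonpositive compactly supported function. -/
theorem mul_integral_le_of_lap_nonneg {N : ℕ} {z η Ψ : EuclideanSpace ℝ (Fin N) → ℝ}
    (hz : ContDiff ℝ 2 z) (hsub : ∀ x, 0 ≤ lap z x) (hη : Continuous η)
    (hηs : HasCompactSupport η) (hΨ : ContDiff ℝ 1 Ψ) (hΨs : HasCompactSupport Ψ)
    (hΨ0 : ∀ y, Ψ y ≤ 0)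
    (hgrad : ∀ y i, fderiv ℝ Ψ y (EuclideanSpace.single i 1) = y i * η y)
    (a : EuclideanSpace ℝ (Fin N)) {R : ℝ} (hR : 0 ≤ R) :
    z a * ∫ y, η y ≤ ∫ y, z (a + R • y) * η y := by
  have hz1 : ContDiff ℝ 1 z := hz.of_le (by norm_num)
  have hd := hasDerivAt_integral_comp_add_smul hz1 hη hηs a
  have hmono : MonotoneOn (fun r : ℝ => ∫ y, z (a + r • y) * η y) (Ici 0) := by
    refine monotoneOn_of_deriv_nonneg (convex_Ici 0)
      (fun r _ => (hd r).continuousAt.continuousWithinAt)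
      (fun r _ => (hd r).differentiableAt.differentiableWithinAt) fun r hr => ?_
    rw [interior_Ici] at hr
    have hr : 0 < r := hr
    rw [(hd r).deriv]
    have hzr : ContDiff ℝ 2 fun y => z (a + r • y) :=
      hz.comp (contDiff_const.add (contDiff_id.const_smul r))
    have hexp : ∀ y : EuclideanSpace ℝ (Fin N), r * (fderiv ℝ z (a + r • y) y * η y)
        = ∑ i : Fin N, fderiv ℝ (fun y => z (a + r • y)) y (EuclideanSpace.single i 1)
          * fderiv ℝ Ψ y (EuclideanSpace.single i 1) := fun y => by
      have hy : y = ∑ i : Fin N, y i • EuclideanSpace.single i (1 : ℝ) := by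
        ext j
        simp [Pi.single_apply]
      conv_lhs => rw [hy, map_sum, ← hy]
      rw [Finset.sum_mul, Finset.mul_sum]
      refine Finset.sum_congr rfl fun i _ => ?_
      rw [fderiv_comp_add_smul, hgrad]
      simp
      ring
    have hi : ∀ i ∈ Finset.univ, Integrable fun y : EuclideanSpace ℝ (Fin N) =>
        fderiv ℝ (fun y => z (a + r • y)) y (EuclideanSpace.single i 1)
          * fderiv ℝ Ψ y (EuclideanSpace.single i 1) := fun i _ =>
      ((contDiff_fderiv_apply (m := 1) hzr (by norm_num) _).continuous.mul
        (contDiff_fderiv_apply (m := 0) hΨ (by simp) _).continuous).integrable_of_hasCompactSupport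
          (hΨs.fderiv_apply ℝ _).mul_left
    have hgreen := integral_sum_fderiv_mul_fderiv hzr hΨ hΨs
    rw [← integral_finsetSum _ hi, ← integral_congr_ae (Eventually.of_forall hexp),
      integral_const_mul, ← integral_neg] at hgreen
    refine nonneg_of_mul_nonneg_right ?_ hr
    rw [hgreen]
    refine integral_nonneg fun y => ?_
    simp only [lap_comp_add_smul, Pi.zero_apply]
    nlinarith [mul_nonneg (mul_nonneg (sq_nonneg r) (hsub (a + r • y))) (neg_nonneg.2 (hΨ0 y))]
  have h := hmono self_mem_Ici hR hR
  simpa [integral_const_mul] using h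

/-- A smooth radial weight as required by `mul_integral_le_of_lap_nonneg`. -/
theorem exists_meanValue_weight {N : ℕ} (hN : 0 < N) :
    ∃ η Ψ : EuclideanSpace ℝ (Fin N) → ℝ, ContDiff ℝ 2 η ∧ ContDiff ℝ 1 Ψ ∧
      HasCompactSupport Ψ ∧ tsupport η ⊆ Metric.closedBall 0 1 ∧ (∀ y, Ψ y ≤ 0) ∧
      (∀ y i, fderiv ℝ Ψ y (EuclideanSpace.single i 1) = y i * η y) ∧ 0 < ∫ y, η y := by
  set σ := Real.smoothTransition
  have hσ : ContDiff ℝ 3 σ := Real.smoothTransition.contDiff (n := 3)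
  have hq : ContDiff ℝ 3 fun y : EuclideanSpace ℝ (Fin N) => 1 - ‖y‖ ^ 2 :=
    contDiff_const.sub (contDiff_norm_sq ℝ)
  have hσ' : ContDiff ℝ 2 (deriv σ) := by
    rw [show (3 : WithTop ℕ∞) = 2 + 1 by norm_num] at hσ
    exact hσ.deriv'
  have hσ0 : ∀ t, 0 ≤ deriv σ t := fun t => Real.smoothTransition.monotone.deriv_nonneg
  have hσz : ∀ t < 0, deriv σ t = 0 := fun t ht => by
    have : σ =ᶠ[𝓝 t] fun _ => 0 := by
      filter_upwards [gt_mem_nhds ht] with s hs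
      exact Real.smoothTransition.zero_of_nonpos hs.le
    simp [this.deriv_eq]
  have hηc : ContDiff ℝ 2 fun y : EuclideanSpace ℝ (Fin N) => deriv σ (1 - ‖y‖ ^ 2) :=
    hσ'.comp (hq.of_le (by norm_num))
  have hηs : tsupport (fun y : EuclideanSpace ℝ (Fin N) => deriv σ (1 - ‖y‖ ^ 2))
      ⊆ Metric.closedBall 0 1 := by
    refine closure_minimal (fun y hy => ?_) Metric.isClosed_closedBall
    by_contra h
    have h1 : 1 < ‖y‖ := by simpa using h
    exact hy (hσz _ (by nlinarith))
  refine ⟨fun y => deriv σ (1 - ‖y‖ ^ 2), fun y => -(1 / 2) * σ (1 - ‖y‖ ^ 2), hηc,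
    contDiff_const.mul ((hσ.comp hq).of_le (by norm_num)), ?_, hηs, fun y => ?_, fun y i => ?_, ?_⟩
  · refine HasCompactSupport.intro (isCompact_closedBall 0 1) fun y hy => ?_
    have h1 : 1 < ‖y‖ := by simpa using hy
    rw [show σ (1 - ‖y‖ ^ 2) = 0 from Real.smoothTransition.zero_of_nonpos (by nlinarith), mul_zero]
  · nlinarith [Real.smoothTransition.nonneg (1 - ‖y‖ ^ 2)]
  · have h1 := (hσ.differentiable (by norm_num) (1 - ‖y‖ ^ 2)).hasDerivAt.comp_hasFDerivAt y
      (hasFDerivAt_one_sub_norm_sq y)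
    refine (congrArg (· (EuclideanSpace.single i 1)) (h1.const_mul (-(1 / 2))).fderiv).trans ?_
    simp [EuclideanSpace.inner_single_right]
    ring
  · obtain ⟨t, ht, hdt⟩ := exists_deriv_eq_slope σ one_pos hσ.continuous.continuousOn
      (hσ.differentiable (by norm_num)).differentiableOn
    rw [show σ 1 = 1 from Real.smoothTransition.one,
      show σ 0 = 0 from Real.smoothTransition.zero] at hdt
    refine Continuous.integral_pos_of_hasCompactSupport_nonneg_nonzero
      (x := EuclideanSpace.single ⟨0, hN⟩ (Real.sqrt (1 - t))) hηc.continuous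
      (HasCompactSupport.of_support_subset_isCompact (isCompact_closedBall 0 1)
        (subset_closure.trans hηs)) (fun y => hσ0 _) ?_
    have h1 : 1 - ‖EuclideanSpace.single (⟨0, hN⟩ : Fin N) (Real.sqrt (1 - t))‖ ^ 2 = t := by
      rw [PiLp.norm_single, Real.norm_eq_abs, sq_abs, Real.sq_sqrt (by linarith [ht.2])]
      ring
    rw [h1, hdt]
    norm_num

theorem exists_fderiv_pow_mul_eq {E : Type*} [NormedAddCommGroup E] [NormedSpace ℝ E]
    {ρ g : E → ℝ} (hρ : ContDiff ℝ (⊤ : ℕ∞) ρ) (hg : ContDiff ℝ (⊤ : ℕ∞) g) (k : ℕ) (v : E) :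
    ∃ g' : E → ℝ, ContDiff ℝ (⊤ : ℕ∞) g' ∧
      ∀ x, fderiv ℝ (fun y => ρ y ^ (k + 1) * g y) x v = ρ x ^ k * g' x := by
  refine ⟨fun x => (k + 1) * fderiv ℝ ρ x v * g x + ρ x * fderiv ℝ g x v,
    ((contDiff_const.mul (contDiff_fderiv_apply hρ (by simp) v)).mul hg).add
      (hρ.mul (contDiff_fderiv_apply hg (by simp) v)), fun x => ?_⟩
  have h1 := (hρ.differentiable (by simp) x).hasFDerivAt
  have h2 := (hg.differentiable (by simp) x).hasFDerivAt
  refine (congrArg (· v) ((h1.pow (k + 1)).mul h2).fderiv).trans ?_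
  simp
  ring

theorem exists_lap_pow_mul_eq {N : ℕ} {ρ g : EuclideanSpace ℝ (Fin N) → ℝ}
    (hρ : ContDiff ℝ (⊤ : ℕ∞) ρ) (hg : ContDiff ℝ (⊤ : ℕ∞) g) (k : ℕ) :
    ∃ g' : EuclideanSpace ℝ (Fin N) → ℝ, ContDiff ℝ (⊤ : ℕ∞) g' ∧
      ∀ x, lap (fun y => ρ y ^ (k + 2) * g y) x = ρ x ^ k * g' x := by
  choose g₁ hg₁ h₁ using fun i : Fin N =>
    exists_fderiv_pow_mul_eq hρ hg (k + 1) (EuclideanSpace.single i (1 : ℝ))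
  choose g₂ hg₂ h₂ using fun i : Fin N =>
    exists_fderiv_pow_mul_eq hρ (hg₁ i) k (EuclideanSpace.single i (1 : ℝ))
  refine ⟨fun x => ∑ i, g₂ i x, ContDiff.sum fun i _ => hg₂ i, fun x => ?_⟩
  unfold lap
  rw [Finset.mul_sum]
  refine Finset.sum_congr rfl fun i _ => ?_
  rw [funext (h₁ i), h₂]

/-- A weak form of Young's inequality. -/
theorem exists_mul_le_half_rpow_add {p : ℝ} (hp : 1 < p) {C : ℝ} (hC : 0 ≤ C) :
    ∃ K, 0 ≤ K ∧ ∀ t : ℝ, 0 ≤ t → C * t ≤ 1 / 2 * t ^ p + K := by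
  have hT : 0 ≤ (2 * C) ^ (1 / (p - 1)) := by positivity
  refine ⟨C * (2 * C) ^ (1 / (p - 1)), by positivity, fun t ht => ?_⟩
  rcases le_total t ((2 * C) ^ (1 / (p - 1))) with h | h
  · have := mul_le_mul_of_nonneg_left h hC
    have := Real.rpow_nonneg ht p
    linarith
  · have h1 : 2 * C ≤ t ^ (p - 1) := by
      have := Real.rpow_le_rpow hT h (by linarith : 0 ≤ p - 1)
      rwa [← Real.rpow_mul (by positivity), one_div_mul_cancel (by linarith), Real.rpow_one] at this
    have h2 : t ^ p = t ^ (p - 1) * t := by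
      rw [show p = (p - 1) + 1 by ring, Real.rpow_add_one' ht (by linarith)]
      ring_nf
    have h3 := mul_le_mul_of_nonneg_right h1 ht
    have h4 : 0 ≤ C * (2 * C) ^ (1 / (p - 1)) := by positivity
    rw [h2]
    linarith

/-- A cut-off function whose bilaplacian can be absorbed by the nonlinearity. -/
theorem exists_cutoff (N : ℕ) {p : ℝ} (hp : 1 < p) :
    ∃ (φ : EuclideanSpace ℝ (Fin N) → ℝ) (K : ℝ), ContDiff ℝ (⊤ : ℕ∞) φ ∧ HasCompactSupport φ ∧
      (∀ y, 0 ≤ φ y) ∧ (∀ y ∈ Metric.closedBall 0 1, φ y = 1) ∧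
      ∀ t : ℝ, 0 ≤ t → ∀ y, t * lap (lap φ) y
        ≤ 1 / 2 * (t ^ p * φ y) + K * (Metric.closedBall 0 2).indicator 1 y := by
  set ρ : ContDiffBump (0 : EuclideanSpace ℝ (Fin N)) := ⟨1, 2, one_pos, one_lt_two⟩
  have hρ : ContDiff ℝ (⊤ : ℕ∞) ρ := ρ.contDiff
  obtain ⟨k, hk⟩ := exists_nat_gt (max 1 (4 / (p - 1)))
  have hk1 : (1 : ℝ) < k := (le_max_left _ _).trans_lt hk
  have hk4 : ((k + 4 : ℕ) : ℝ) ≤ k * p := by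
    have := ((le_max_right _ _).trans_lt hk)
    rw [div_lt_iff₀ (by linarith)] at this
    push_cast
    linarith
  have hk0 : k ≠ 0 := by rintro rfl; norm_num at hk1
  obtain ⟨g₁, hg₁, h₁⟩ := exists_lap_pow_mul_eq hρ (contDiff_const (c := (1 : ℝ))) (k + 2)
  obtain ⟨g₂, hg₂, h₂⟩ := exists_lap_pow_mul_eq hρ hg₁ k
  have hlap : ∀ y, lap (lap fun y => ρ y ^ (k + 4)) y = ρ y ^ k * g₂ y := fun y => by
    rw [← h₂, ← funext h₁]
    simp
  obtain ⟨C, hC⟩ := (isCompact_closedBall (0 : EuclideanSpace ℝ (Fin N))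
    2).exists_bound_of_continuousOn hg₂.continuous.continuousOn
  obtain ⟨K, hK0, hK⟩ := exists_mul_le_half_rpow_add hp (le_max_right C 0)
  have hzero : ∀ y ∉ Metric.closedBall (0 : EuclideanSpace ℝ (Fin N)) 2, ρ y = 0 := fun y hy =>
    ρ.zero_of_le_dist (show 2 ≤ dist y 0 from (not_le.1 hy).le)
  refine ⟨fun y => ρ y ^ (k + 4), K, hρ.pow _,
    HasCompactSupport.intro (isCompact_closedBall 0 2) fun y hy => by simp [hzero y hy],
    fun y => pow_nonneg ρ.nonneg _, fun y hy => by simp [ρ.one_of_mem_closedBall hy],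
    fun t ht y => ?_⟩
  rw [hlap]
  by_cases hy : y ∈ Metric.closedBall (0 : EuclideanSpace ℝ (Fin N)) 2
  · have hr0 : 0 ≤ ρ y := ρ.nonneg
    have h3 := hK (t * ρ y ^ k) (by positivity)
    have h4 : g₂ y ≤ max C 0 := (le_abs_self _).trans ((hC y hy).trans (le_max_left _ _))
    have h5 := mul_le_mul_of_nonneg_right h4 (by positivity : 0 ≤ t * ρ y ^ k)
    have h6 : (t * ρ y ^ k) ^ p ≤ t ^ p * ρ y ^ (k + 4) := by
      rw [Real.mul_rpow ht (by positivity)]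
      refine mul_le_mul_of_nonneg_left ?_ (by positivity)
      rw [← Real.rpow_natCast, ← Real.rpow_mul hr0, ← Real.rpow_natCast]
      rcases hr0.eq_or_lt with h | h
      · rw [← h, Real.zero_rpow (by positivity), Real.zero_rpow (by positivity)]
      · exact Real.rpow_le_rpow_of_exponent_ge h ρ.le_one hk4
    simp only [indicator_of_mem hy, Pi.one_apply, mul_one]
    linarith
  · simp [hzero y hy, hy, hk0]

/-- Positive solutions of `Δ²u = u^p` with `p > 1` are superharmonic. -/
theorem lap_nonpos_of_lap_lap_eq_rpow {N : ℕ} (hN : 0 < N) {p : ℝ} (hp : 1 < p)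
    {u : EuclideanSpace ℝ (Fin N) → ℝ} (hu : ContDiff ℝ 4 u) (hpos : ∀ x, 0 < u x)
    (heq : ∀ x, lap (lap u) x = u x ^ p) (a : EuclideanSpace ℝ (Fin N)) : lap u a ≤ 0 := by
  obtain ⟨φ, K, hφ, hφs, hφ0, hφ1, hφK⟩ := exists_cutoff N hp
  obtain ⟨η, Ψ, hη, hΨ, hΨs, hηs, hΨ0, hgrad, hηpos⟩ := exists_meanValue_weight hN
  have hηc : HasCompactSupport η :=
    (isCompact_closedBall 0 1).of_isClosed_subset isClosed_closure hηs
  set χ : EuclideanSpace ℝ (Fin N) → ℝ := (Metric.closedBall 0 2).indicator 1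
  have hχ : Integrable χ := (integrable_indicator_iff measurableSet_closedBall).2
    (integrableOn_const (isCompact_closedBall _ _).measure_ne_top)
  have hχ0 : ∀ y, 0 ≤ χ y := fun y => indicator_nonneg (fun _ _ => zero_le_one) y
  have hlapη : Continuous (lap η) := (contDiff_lap (m := 0) hη (by norm_num)).continuous
  obtain ⟨C, hC⟩ := (isCompact_closedBall (0 : EuclideanSpace ℝ (Fin N))
    1).exists_bound_of_continuousOn hlapη.continuousOn
  have hC0 : 0 ≤ C := (norm_nonneg _).trans (hC 0 (by simp))
  have hlu : ContDiff ℝ 2 (lap u) := contDiff_lap hu (by norm_num)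
  have key : ∀ R : ℝ, 1 ≤ R →
      R ^ 2 * (lap u a * ∫ y, η y) ≤ C * (2 * (K * ∫ y, χ y) + ∫ y, χ y) := by
    intro R hR
    set U : EuclideanSpace ℝ (Fin N) → ℝ := fun y => u (a + R • y) with hUdef
    have hU : ContDiff ℝ 4 U := hu.comp (contDiff_const.add (contDiff_id.const_smul R))
    have hUpos : ∀ y, 0 < U y := fun y => hpos _
    have hlapU : lap U = fun y => R ^ 2 * lap u (a + R • y) :=
      funext fun y => lap_comp_add_smul u a R y
    have hlaplapU : ∀ y, lap (lap U) y = R ^ 4 * U y ^ p := fun y => by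
      have h1 : lap (fun y => 0 + R ^ 2 * lap u (a + R • y)) y
          = lap (fun _ => 0) y + R ^ 2 * lap (fun y => lap u (a + R • y)) y :=
        lap_add_const_mul contDiffAt_const
          (hlu.comp (contDiff_const.add (contDiff_id.const_smul R))).contDiffAt _
      simp only [zero_add] at h1
      rw [hlapU, h1, lap_comp_add_smul, heq]
      simp [lap]
      ring
    have hUp : Continuous fun y => U y ^ p :=
      hU.continuous.rpow_const fun y => Or.inl (hUpos y).ne'
    have hI : Integrable fun y => U y ^ p * φ y :=
      (hUp.mul hφ.continuous).integrable_of_hasCompactSupport hφs.mul_left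
    have hI0 : 0 ≤ ∫ y, U y ^ p * φ y :=
      integral_nonneg fun y => mul_nonneg (Real.rpow_nonneg (hUpos y).le _) (hφ0 y)
    have hφ4 : ContDiff ℝ 4 φ := mod_cast contDiff_infty.1 hφ 4
    have hlφ : ContDiff ℝ 2 (lap φ) := contDiff_lap hφ4 (by norm_num)
    have hlφs := hasCompactSupport_lap hφs
    have hllφ : Continuous (lap (lap φ)) := (contDiff_lap (m := 0) hlφ (by norm_num)).continuous
    have hgreen : R ^ 4 * ∫ y, U y ^ p * φ y = ∫ y, U y * lap (lap φ) y := by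
      rw [← integral_lap_mul (hU.of_le (by norm_num)) hlφ hlφs,
        ← integral_lap_mul (contDiff_lap hU (by norm_num)) (hφ4.of_le (by norm_num)) hφs,
        ← integral_const_mul]
      simp_rw [hlaplapU, mul_assoc]
    have hIle : ∫ y, U y ^ p * φ y ≤ 2 * (K * ∫ y, χ y) := by
      have h1 : ∫ y, U y * lap (lap φ) y ≤ ∫ y, (1 / 2 * (U y ^ p * φ y) + K * χ y) :=
        integral_mono ((hU.continuous.mul hllφ).integrable_of_hasCompactSupport
          (hasCompactSupport_lap hlφs).mul_left) ((hI.const_mul _).add (hχ.const_mul _))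
          fun y => hφK _ (hUpos y).le y
      rw [integral_add (hI.const_mul _) (hχ.const_mul _), integral_const_mul, integral_const_mul,
        ← hgreen] at h1
      have h2 := mul_le_mul_of_nonneg_right (one_le_pow₀ hR (n := 4)) hI0
      linarith
    have hmean := mul_integral_le_of_lap_nonneg hlu
      (fun x => (heq x).symm ▸ Real.rpow_nonneg (hpos x).le p) hη.continuous hηc hΨ hΨs hΨ0 hgrad a
      (zero_le_one.trans hR)
    have hηU : R ^ 2 * ∫ y, lap u (a + R • y) * η y = ∫ y, U y * lap η y := by
      rw [← integral_lap_mul (hU.of_le (by norm_num)) hη hηc, hlapU, ← integral_const_mul]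
      simp_rw [mul_assoc]
    have hUη : ∫ y, U y * lap η y ≤ ∫ y, C * (U y ^ p * φ y + χ y) := by
      refine integral_mono ((hU.continuous.mul hlapη).integrable_of_hasCompactSupport
        (hasCompactSupport_lap hηc).mul_left) ((hI.add hχ).const_mul _) fun y => ?_
      have hUy := hUpos y
      by_cases hy : y ∈ Metric.closedBall (0 : EuclideanSpace ℝ (Fin N)) 1
      · have h1 : χ y = 1 :=
          indicator_of_mem (Metric.closedBall_subset_closedBall one_le_two hy) _
        have h2 : U y ≤ U y ^ p + 1 := by
          rcases le_total (U y) 1 with h | h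
          · linarith [Real.rpow_nonneg hUy.le p]
          · linarith [Real.self_le_rpow_of_one_le h hp.le]
        have h3 : lap η y ≤ C := (le_abs_self _).trans (hC y hy)
        simp only [hφ1 y hy, h1, mul_one]
        nlinarith
      · have h1 : lap η y = 0 := by
          by_contra h
          exact hy (hηs (support_lap_subset η h))
        simp only [h1, mul_zero]
        have := hχ0 y
        have := hφ0 y
        positivity
    rw [integral_const_mul, integral_add hI hχ] at hUη
    have h3 := mul_le_mul_of_nonneg_left hmean (sq_nonneg R)
    have h4 := mul_le_mul_of_nonneg_left hIle hC0
    linarith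
  by_contra! h
  have ht : Tendsto (fun R : ℝ => R ^ 2 * (lap u a * ∫ y, η y)) atTop atTop :=
    (tendsto_pow_atTop two_ne_zero).atTop_mul_const (mul_pos h hηpos)
  obtain ⟨R, hR1, hR2⟩ := ((ht.eventually_gt_atTop _).and (eventually_ge_atTop 1)).exists
  exact (key R hR2).not_gt hR1

/-- Souplet-type estimate: any classical stable solution of `Δ²u = u^p`, `u > 0` in `ℝ^N`
satisfies `v = -Δu ≥ √(2/(p+1)) u^{(p+1)/2}`; in particular `v > 0` everywhere. -/
theorem souplet_estimate
    (N : ℕ) (hN : 5 ≤ N) (p : ℝ) (hp : 1 < p)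
    (u : EuclideanSpace ℝ (Fin N) → ℝ)
    (hu : ContDiff ℝ 4 u) (hpos : ∀ x, 0 < u x)
    (heq : ∀ x, lap (lap u) x = u x ^ p)
    (hstable : ∀ φ : EuclideanSpace ℝ (Fin N) → ℝ, ContDiff ℝ (⊤ : ℕ∞) φ →
      HasCompactSupport φ →
      p * ∫ x, u x ^ (p - 1) * φ x ^ 2 ≤ ∫ x, (lap φ x) ^ 2) :
    ∀ x, Real.sqrt (2 / (p + 1)) * u x ^ ((p + 1) / 2) ≤ -(lap u x)
      ∧ 0 < -(lap u x) := by
  set q := (p + 1) / 2 with hq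
  set l := Real.sqrt (2 / (p + 1))
  have hl : 0 < l := Real.sqrt_pos.2 (by positivity)
  have hq1 : 1 < q := by rw [hq]; linarith
  have hlq : l * q * l = 1 := by
    rw [mul_right_comm, Real.mul_self_sqrt (by positivity), hq]
    field_simp
  have hlu : ContDiff ℝ 2 (lap u) := contDiff_lap hu (by norm_num)
  have hu2 : ContDiff ℝ 2 u := hu.of_le (by norm_num)
  have huq : ContDiff ℝ 2 fun x => u x ^ q := hu2.rpow_const_of_ne fun x => (hpos x).ne'
  have hmain : ∀ x, lap u x + l * u x ^ q ≤ 0 := by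
    refine nonpos_of_lap_ge (hlu.add (contDiff_const.mul huq))
      (c := l * q / l ^ ((q - 1) / q)) (s := (q - 1) / q + 1) (by positivity)
      (by linarith [div_pos (sub_pos.2 hq1) (one_pos.trans hq1)]) fun x hx => ?_
    have hux := hpos x
    set w := lap u x + l * u x ^ q
    have hwu : w / l ≤ u x ^ q := by
      rw [div_le_iff₀ hl]
      linarith [lap_nonpos_of_lap_lap_eq_rpow (by omega) hp hu hpos heq x]
    have h1 : (w / l) ^ ((q - 1) / q) ≤ u x ^ (q - 1) := by
      calc _ ≤ (u x ^ q) ^ ((q - 1) / q) :=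
            Real.rpow_le_rpow (by positivity) hwu (by have := sub_pos.2 hq1; positivity)
        _ = u x ^ (q - 1) := by
            rw [← Real.rpow_mul hux.le, mul_div_cancel₀ _ (by linarith)]
    rw [lap_add_const_mul hlu.contDiffAt huq.contDiffAt, heq, lap_rpow hu2.contDiffAt hux]
    have h2 : 0 ≤ l * (q * (q - 1) * u x ^ (q - 2)
        * ∑ i : Fin N, fderiv ℝ u x (EuclideanSpace.single i 1) ^ 2) := by
      have := sub_pos.2 hq1
      positivity
    have h3 : u x ^ p = l * q * u x ^ (q - 1) * (l * u x ^ q) := by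
      have : u x ^ p = u x ^ (q - 1) * u x ^ q := by
        rw [← Real.rpow_add hux]
        congr 1
        rw [hq]; ring
      rw [this]
      linear_combination -(u x ^ (q - 1) * u x ^ q) * hlq
    calc l * q / l ^ ((q - 1) / q) * w ^ ((q - 1) / q + 1)
        = l * q * (w / l) ^ ((q - 1) / q) * w := by
          rw [Real.rpow_add_one hx.ne', Real.div_rpow hx.le hl.le]
          ring
      _ ≤ l * q * u x ^ (q - 1) * w := by gcongr
      _ = u x ^ p + l * (q * u x ^ (q - 1) * lap u x) := by rw [h3]; ring
      _ ≤ _ := by linarith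
  intro x
  have h1 : 0 < l * u x ^ q := mul_pos hl (Real.rpow_pos_of_pos (hpos x) q)
  have h2 := hmain x
  exact ⟨by linarith, by linarith⟩
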